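/- Let n ≥ 4 be an even integer and let ε_1, …, ε_n ∈ {+1, −1} with ∑_{i=1}^n ε_i = 0. Then for every real number θ, the point x = (ε_1 θ, ε_2 θ, …, ε_{n-1} θ) ∈ ℝ^{n-1} is a critical point of the signed area function f, and f(x) = 0. Hence f possesses one-parameter families (zigzag trains) of non-isolated critical points. -/

import Mathlib

/-- The derivative of the signed area function in reduced coordinates. -/
theorem hasFDerivAt_sum_sin_sub_sin_sum {ι : Type*} [Fintype ι] (x : ι → ℝ) :
    HasFDerivAt (fun y : ι → ℝ => (∑ i, Real.sin (y i)) - Real.sin (∑ i, y i))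
      ((∑ i, Real.cos (x i) • ContinuousLinearMap.proj (R := ℝ) (φ := fun _ : ι => ℝ) i) -
        Real.cos (∑ i, x i) •
          ∑ i, ContinuousLinearMap.proj (R := ℝ) (φ := fun _ : ι => ℝ) i) x :=
  (HasFDerivAt.fun_sum fun i _ => (hasFDerivAt_apply i x).sin).sub
    (HasFDerivAt.fun_sum fun i _ => hasFDerivAt_apply i x).sin

theorem sin_sign_mul {e : ℝ} (he : e = 1 ∨ e = -1) (θ : ℝ) :
    Real.sin (e * θ) = e * Real.sin θ := by
  rcases he with rfl | rfl <;> simp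

theorem cos_sign_mul {e : ℝ} (he : e = 1 ∨ e = -1) (θ : ℝ) :
    Real.cos (e * θ) = Real.cos θ := by
  rcases he with rfl | rfl <;> simp

/-- Zigzag trains: for even `n ≥ 4` and signs `ε_i ∈ {±1}` with `∑ ε_i = 0`,
every point `x = (ε_1 θ, …, ε_{n-1} θ)` is a critical point of the signed area
function, with critical value `0`; hence a one-parameter family of critical points. -/
theorem zigzag_train_critical (n : ℕ) (hn : 4 ≤ n) (hne : Even n)
    (ε : Fin n → ℝ) (hε : ∀ i, ε i = 1 ∨ ε i = -1) (hsum : ∑ i, ε i = 0) (θ : ℝ) :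
    let f : (Fin (n - 1) → ℝ) → ℝ :=
      fun y => (∑ i, Real.sin (y i)) - Real.sin (∑ i, y i)
    let x : Fin (n - 1) → ℝ := fun i => ε (Fin.castLE (Nat.sub_le n 1) i) * θ
    fderiv ℝ f x = 0 ∧ f x = 0 := by
  intro f x
  obtain ⟨m, rfl⟩ : ∃ m, n = m + 1 := ⟨n - 1, by omega⟩
  have hlast : ∑ i, ε (Fin.castLE (Nat.sub_le (m + 1) 1) i) = -ε (Fin.last m) := by
    rw [Fin.sum_univ_castSucc] at hsum
    exact eq_neg_of_add_eq_zero_left hsum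
  have hx : ∑ i, x i = -(ε (Fin.last m) * θ) := by
    simp only [x]
    rw [← Finset.sum_mul, hlast, neg_mul]
  constructor
  · have h : HasFDerivAt f _ x := hasFDerivAt_sum_sin_sub_sin_sum x
    rw [h.fderiv, hx, Real.cos_neg, cos_sign_mul (hε _), Finset.smul_sum, sub_eq_zero]
    exact Finset.sum_congr rfl fun i _ => by rw [cos_sign_mul (hε _)]
  · have hsin : ∑ i, Real.sin (x i) = -ε (Fin.last m) * Real.sin θ := by
      rw [← hlast, Finset.sum_mul]
      exact Finset.sum_congr rfl fun i _ => sin_sign_mul (hε _) θ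
    simp only [f]
    rw [hsin, hx, Real.sin_neg, sin_sign_mul (hε _)]
    ring
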